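/- arXiv:2505.10048 — 10 statements merged into one kernel-verified Lean document; each statement's English description precedes it below -/
import Mathlib

section
/- For all positive real numbers k, k₁, R, ω, κ, there exists at least one positive real number r satisfying the spiral equilibrium equation r³ − R²·e^{2k₁(r−κ)}·r + k/ω = 0. -/
open Real

/-- For all positive real numbers `k, k₁, R, ω, κ`, there exists at least one
positive real number `r` satisfying the spiral equilibrium equation
`r³ − R²·e^{2k₁(r−κ)}·r + k/ω = 0`. -/
theorem spiral_equilibrium_exists
    (k k₁ R ω κ : ℝ) (hk : 0 < k) (hk₁ : 0 < k₁) (hR : 0 < R) (hω : 0 < ω) (hκ : 0 < κ) :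
    ∃ r : ℝ, 0 < r ∧ r ^ 3 - R ^ 2 * Real.exp (2 * k₁ * (r - κ)) * r + k / ω = 0 := by
  have hA : 0 < k / ω := div_pos hk hω
  set A := k / ω with hAdef
  have hC : 0 < R ^ 2 * Real.exp (-(2 * k₁ * κ)) := by positivity
  set C := R ^ 2 * Real.exp (-(2 * k₁ * κ)) with hCdef
  have hsplit : ∀ r : ℝ, R ^ 2 * Real.exp (2 * k₁ * (r - κ)) = C * Real.exp (2 * k₁ * r) := by
    intro r
    rw [hCdef, mul_assoc (R ^ 2), ← Real.exp_add]
    congr 2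
    ring
  obtain ⟨x, hx1, hx2⟩ := (((Real.tendsto_exp_div_pow_atTop 3).eventually_ge_atTop
    ((1 + A) / (C * (2 * k₁) ^ 3))).and (Filter.eventually_ge_atTop (2 * k₁))).exists
  have hx0 : 0 < x := by linarith
  obtain ⟨b, rfl⟩ : ∃ b, x = 2 * k₁ * b := ⟨x / (2 * k₁), by field_simp⟩
  have hb : 1 ≤ b := by
    by_contra h
    push Not at h
    nlinarith
  rw [div_le_div_iff₀ (by positivity) (by positivity)] at hx1
  have hE : (1 + A) * b ^ 3 ≤ C * Real.exp (2 * k₁ * b) := by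
    have h3 : 0 < (2 * k₁) ^ 3 := by positivity
    refine le_of_mul_le_mul_right ?_ h3
    calc (1 + A) * b ^ 3 * (2 * k₁) ^ 3 = (1 + A) * (2 * k₁ * b) ^ 3 := by ring
      _ ≤ _ := hx1
      _ = _ := by ring
  have hb3 : 1 ≤ b ^ 3 := one_le_pow₀ hb
  have hfb : b ^ 3 - R ^ 2 * Real.exp (2 * k₁ * (b - κ)) * b + A ≤ 0 := by
    rw [hsplit]
    have h1 : C * Real.exp (2 * k₁ * b) * 1 ≤ C * Real.exp (2 * k₁ * b) * b :=
      mul_le_mul_of_nonneg_left hb (by positivity)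
    nlinarith
  have hcont : ContinuousOn
      (fun r : ℝ => r ^ 3 - R ^ 2 * Real.exp (2 * k₁ * (r - κ)) * r + A) (Set.Icc 0 b) := by
    fun_prop
  obtain ⟨r, hr, hr0⟩ := intermediate_value_Icc' (by linarith : (0:ℝ) ≤ b) hcont
    (show (0:ℝ) ∈ Set.Icc _ _ from ⟨hfb, by simpa using hA.le⟩)
  refine ⟨r, lt_of_le_of_ne hr.1 ?_, hr0⟩
  rintro rfl
  simp at hr0
  linarith
end

section
/- Let k, k₁, R, ω, κ be positive real numbers with 2k₁²R² > 1 and κ < ln(2k₁²R²)/(2k₁). Then there exists exactly one positive real number r satisfying the spiral equilibrium equation r³ − R²·e^{2k₁(r−κ)}·r + k/ω = 0. -/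
open Real

theorem spiral_aux_mono (A k₁ a b : ℝ) (hk₁ : 0 < k₁) (hA : 1 < 2 * k₁ ^ 2 * A) (ha : 0 < a)
    (hab : a < b) :
    A * Real.exp (2 * k₁ * a) - a ^ 2 < A * Real.exp (2 * k₁ * b) - b ^ 2 := by
  have hA0 : 0 < A := by
    by_contra h
    have : 2 * k₁ ^ 2 * A ≤ 0 := mul_nonpos_of_nonneg_of_nonpos (by positivity) (not_lt.mp h)
    linarith
  obtain ⟨d, hd, rfl⟩ : ∃ d, 0 < d ∧ b = a + d := ⟨b - a, by linarith, by ring⟩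
  have e1 : Real.exp (2 * k₁ * (a + d)) = Real.exp (2 * k₁ * a) * Real.exp (2 * k₁ * d) := by
    rw [← Real.exp_add]; ring_nf
  rw [e1]
  have h1 := Real.add_one_le_exp (2 * k₁ * a)
  have h2 := Real.quadratic_le_exp_of_nonneg (x := 2 * k₁ * d) (by positivity)
  have h3 : (2 * k₁ * a + 1) * (2 * k₁ * d + (2 * k₁ * d) ^ 2 / 2)
      ≤ Real.exp (2 * k₁ * a) * (Real.exp (2 * k₁ * d) - 1) :=
    mul_le_mul h1 (by linarith) (by positivity) (by positivity)
  have h4 := mul_le_mul_of_nonneg_left h3 hA0.le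
  have h5 : 2 * a * d + d ^ 2 < (2 * k₁ ^ 2 * A) * (2 * a * d + d ^ 2) := by
    have : 0 < 2 * a * d + d ^ 2 := by positivity
    nlinarith
  have h6 : (2 * k₁ ^ 2 * A) * (2 * a * d + d ^ 2)
      ≤ A * ((2 * k₁ * a + 1) * (2 * k₁ * d + (2 * k₁ * d) ^ 2 / 2)) := by
    have : 0 ≤ A * (2 * k₁ * d + 4 * k₁ ^ 3 * a * d ^ 2) := by positivity
    linarith
  linarith

/-- If `2k₁²R² > 1` and `κ < ln(2k₁²R²)/(2k₁)`, then there exists exactly one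
positive real number `r` satisfying the spiral equilibrium equation
`r³ − R²·e^{2k₁(r−κ)}·r + k/ω = 0`. -/
theorem spiral_equilibrium_unique
    (k k₁ R ω κ : ℝ) (hk : 0 < k) (hk₁ : 0 < k₁) (hR : 0 < R) (hω : 0 < ω) (hκ : 0 < κ)
    (hgain : 1 < 2 * k₁ ^ 2 * R ^ 2)
    (hκ' : κ < Real.log (2 * k₁ ^ 2 * R ^ 2) / (2 * k₁)) :
    ∃! r : ℝ, 0 < r ∧ r ^ 3 - R ^ 2 * Real.exp (2 * k₁ * (r - κ)) * r + k / ω = 0 := by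
  obtain ⟨A, hAdef⟩ : ∃ A, A = R ^ 2 * Real.exp (-(2 * k₁ * κ)) := ⟨_, rfl⟩
  have hA0 : 0 < A := by rw [hAdef]; positivity
  have hA : 1 < 2 * k₁ ^ 2 * A := by
    rw [lt_div_iff₀ (by positivity), Real.lt_log_iff_exp_lt (by linarith)] at hκ'
    have h := mul_lt_mul_of_pos_right hκ' (Real.exp_pos (-(κ * (2 * k₁))))
    rw [← Real.exp_add, add_neg_cancel, Real.exp_zero] at h
    rw [hAdef, show 2 * k₁ * κ = κ * (2 * k₁) by ring]
    linarith
  have hE : ∀ r, R ^ 2 * Real.exp (2 * k₁ * (r - κ)) = A * Real.exp (2 * k₁ * r) := by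
    intro r
    rw [hAdef, mul_assoc (R ^ 2), ← Real.exp_add]; ring_nf
  simp only [hE]
  obtain ⟨c, hcdef⟩ : ∃ c, c = k / ω := ⟨_, rfl⟩
  have hc : 0 < c := by rw [hcdef]; positivity
  rw [← hcdef]
  have key : ∀ a b : ℝ, 0 < a → a ^ 3 - A * Real.exp (2 * k₁ * a) * a + c = 0 →
      b ^ 3 - A * Real.exp (2 * k₁ * b) * b + c = 0 → a < b → False := by
    intro a b ha h1 h2 hab
    have hm := spiral_aux_mono A k₁ a b hk₁ hA ha hab
    have ea : a * (A * Real.exp (2 * k₁ * a) - a ^ 2) = c := by linarith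
    have eb : b * (A * Real.exp (2 * k₁ * b) - b ^ 2) = c := by linarith
    have hp : 0 < A * Real.exp (2 * k₁ * a) - a ^ 2 := by
      by_contra h
      have := mul_nonpos_of_nonneg_of_nonpos ha.le (not_lt.mp h)
      linarith
    have := mul_lt_mul hab hm.le hp (by linarith)
    linarith
  obtain ⟨M, hM⟩ : ∃ M, M = c / (2 * k₁ * A) + 1 := ⟨_, rfl⟩
  have hq : 0 < c / (2 * k₁ * A) := by positivity
  have hM1 : 1 < M := by linarith
  have hM0 : 0 < M := by linarith
  have hcM : c < 2 * k₁ * A * M := by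
    rw [hM, mul_add, mul_div_cancel₀ _ (by positivity)]
    have : 0 < 2 * k₁ * A := by positivity
    linarith
  have hfM : M ^ 3 - A * Real.exp (2 * k₁ * M) * M + c ≤ 0 := by
    have h2 := Real.quadratic_le_exp_of_nonneg (x := 2 * k₁ * M) (by positivity)
    have h3 := mul_le_mul_of_nonneg_left h2 (show 0 ≤ A * M by positivity)
    have h4 : M ^ 3 ≤ (2 * k₁ ^ 2 * A) * M ^ 3 := by
      have : 0 < M ^ 3 := by positivity
      nlinarith
    have h5 : 2 * k₁ * A * M ≤ 2 * k₁ * A * M * M :=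
      le_mul_of_one_le_right (by positivity) hM1.le
    have h6 : 0 < A * M := by positivity
    linarith
  have hcont : ContinuousOn (fun r : ℝ => r ^ 3 - A * Real.exp (2 * k₁ * r) * r + c)
      (Set.Icc 0 M) := by fun_prop
  obtain ⟨r, hr, hr0⟩ := intermediate_value_Icc' hM0.le hcont
    (show (0 : ℝ) ∈ Set.Icc _ _ from ⟨hfM, by simpa using hc.le⟩)
  have hr0' : r ^ 3 - A * Real.exp (2 * k₁ * r) * r + c = 0 := hr0
  have hrpos : 0 < r := by
    rcases hr.1.lt_or_eq with h | h
    · exact h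
    · rw [← h] at hr0'
      simp at hr0'
      linarith
  refine ⟨r, ⟨hrpos, hr0'⟩, ?_⟩
  rintro y ⟨hy, hy0⟩
  rcases lt_trichotomy y r with h | h | h
  · exact (key y r hy hy0 hr0' h).elim
  · exact h
  · exact (key r y hrpos hr0' hy0 h).elim
end

section
/- Let k₁, R be positive real numbers with 2k₁²R² > 1, and let κ satisfy 0 < κ < ln(2k₁²R²)/(2k₁). Then for every r > 0, the quantity r/(R·e^{k₁(r−κ)}) is strictly less than √2/e, and in particular strictly less than 1. -/
open Real

/-- If `2k₁²R² > 1` and `0 < κ < ln(2k₁²R²)/(2k₁)`, then for every `r > 0` the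
quantity `r/(R·e^{k₁(r−κ)})` is strictly less than `√2/e`, and in particular strictly less
than `1`. -/
theorem cos_equilibrium_angle_bound
    (k₁ R κ : ℝ) (hk₁ : 0 < k₁) (hR : 0 < R)
    (hgain : 1 < 2 * k₁ ^ 2 * R ^ 2)
    (hκ : 0 < κ) (hκ' : κ < Real.log (2 * k₁ ^ 2 * R ^ 2) / (2 * k₁)) :
    ∀ r : ℝ, 0 < r →
      r / (R * Real.exp (k₁ * (r - κ))) < Real.sqrt 2 / Real.exp 1 ∧
      r / (R * Real.exp (k₁ * (r - κ))) < 1 := by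
  intro r hr
  have h1 : Real.exp (k₁ * κ) < Real.sqrt 2 * k₁ * R := by
    have h2 : κ * (2 * k₁) < Real.log (2 * k₁ ^ 2 * R ^ 2) :=
      (lt_div_iff₀ (by positivity)).1 hκ'
    have h3 : Real.exp (κ * (2 * k₁)) < 2 * k₁ ^ 2 * R ^ 2 :=
      (Real.lt_log_iff_exp_lt (by positivity)).1 h2
    have h4 : Real.exp (κ * (2 * k₁)) = Real.exp (k₁ * κ) ^ 2 := by
      rw [← Real.exp_nat_mul]; congr 1; push_cast; ring
    have h5 : (Real.sqrt 2 * k₁ * R) ^ 2 = 2 * k₁ ^ 2 * R ^ 2 := by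
      rw [mul_pow, mul_pow, Real.sq_sqrt (by norm_num)]
    apply lt_of_pow_lt_pow_left₀ 2 (by positivity)
    rw [h5, ← h4]; exact h3
  have h6 : k₁ * r * Real.exp 1 ≤ Real.exp (k₁ * r) := by
    have h := Real.add_one_le_exp (k₁ * r - 1)
    rw [Real.exp_sub, le_div_iff₀ (Real.exp_pos 1)] at h
    linarith
  have key : r / (R * Real.exp (k₁ * (r - κ))) < Real.sqrt 2 / Real.exp 1 := by
    rw [div_lt_div_iff₀ (by positivity) (by positivity), mul_sub, Real.exp_sub,
      ← mul_div_assoc, ← mul_div_assoc, lt_div_iff₀ (Real.exp_pos _)]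
    calc r * Real.exp 1 * Real.exp (k₁ * κ)
        < r * Real.exp 1 * (Real.sqrt 2 * k₁ * R) :=
          mul_lt_mul_of_pos_left h1 (by positivity)
      _ = Real.sqrt 2 * R * (k₁ * r * Real.exp 1) := by ring
      _ ≤ Real.sqrt 2 * R * Real.exp (k₁ * r) :=
          mul_le_mul_of_nonneg_left h6 (by positivity)
      _ = Real.sqrt 2 * (R * Real.exp (k₁ * r)) := by ring
  refine ⟨key, key.trans ?_⟩
  rw [div_lt_one (Real.exp_pos 1)]
  have h7 : Real.sqrt 2 < 2 := by
    rw [Real.sqrt_lt' (by norm_num)]; norm_num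
  have h8 := Real.add_one_le_exp (1 : ℝ)
  linarith
end

section
/- Let k, k₁, R, ω, κ be positive real numbers with 2k₁²R² > 1 and κ < ln(2k₁²R²)/(2k₁). Then there exists a unique pair (r, ψ) with r > 0 and ψ ∈ (−π, π] satisfying the equilibrium equations r = R·e^{k₁(r−κ)}·cos(ψ) and ω = k·R·e^{k₁(r−κ)}·sin(ψ) / ( r·( r² + R²·e^{2k₁(r−κ)} − 2·r·R·e^{k₁(r−κ)}·cos(ψ) )^{3/2} ). Moreover, this unique ψ lies in the open interval (0, π/2). -/
open Real


lemma sp_exp (k₁ r κ : ℝ) : Real.exp (2 * k₁ * (r - κ)) = Real.exp (k₁ * (r - κ)) ^ 2 := by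
  rw [← Real.exp_nat_mul]; congr 1; push_cast; ring

lemma sp_mono (A k₁ a b : ℝ) (hk₁ : 0 < k₁) (hA : 1 < 2 * k₁ ^ 2 * A) (ha : 0 ≤ a) (hab : a < b) :
    A * Real.exp (2 * k₁ * a) - a ^ 2 < A * Real.exp (2 * k₁ * b) - b ^ 2 := by
  have hA0 : 0 < A := by
    by_contra h
    have : k₁ ^ 2 * A ≤ 0 := mul_nonpos_of_nonneg_of_nonpos (by positivity) (not_lt.1 h)
    linarith
  obtain ⟨d, rfl⟩ : ∃ d, b = a + d := ⟨b - a, by ring⟩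
  have hd : 0 < d := by linarith
  have e1 : Real.exp (2 * k₁ * (a + d)) = Real.exp (2 * k₁ * a) * Real.exp (2 * k₁ * d) := by
    rw [← Real.exp_add]; congr 1; ring
  have h1 : 2 * k₁ * a + 1 ≤ Real.exp (2 * k₁ * a) := Real.add_one_le_exp _
  have h2 : 1 + 2 * k₁ * d + (2 * k₁ * d) ^ 2 / 2 ≤ Real.exp (2 * k₁ * d) :=
    Real.quadratic_le_exp_of_nonneg (by positivity)
  have h3 : (2 * k₁ * a + 1) * (2 * k₁ * d + (2 * k₁ * d) ^ 2 / 2)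
      ≤ Real.exp (2 * k₁ * a) * (Real.exp (2 * k₁ * d) - 1) :=
    mul_le_mul h1 (by linarith) (by positivity) (by positivity)
  have h4 := mul_le_mul_of_nonneg_left h3 hA0.le
  have h5 : 2 * a * d + d ^ 2 < A * ((2 * k₁ * a + 1) * (2 * k₁ * d + (2 * k₁ * d) ^ 2 / 2)) := by
    have : A * ((2 * k₁ * a + 1) * (2 * k₁ * d + (2 * k₁ * d) ^ 2 / 2))
      = (2 * k₁ ^ 2 * A) * (2 * a * d + d ^ 2) + A * (2 * k₁ * d + 4 * k₁ ^ 3 * a * d ^ 2) := by ring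
    rw [this]
    have p1 : 0 < 2 * a * d + d ^ 2 := by positivity
    have p2 : 0 < A * (2 * k₁ * d + 4 * k₁ ^ 3 * a * d ^ 2) := by positivity
    nlinarith
  rw [e1]
  nlinarith

lemma sp_key (k ω r E ψ : ℝ) (hk : 0 < k) (hω : 0 < ω) (hr : 0 < r) (hE : 0 < E)
    (h1 : r = E * Real.cos ψ) :
    ω = k * E * Real.sin ψ / (r * (r ^ 2 + E ^ 2 - 2 * r * E * Real.cos ψ) ^ ((3 : ℝ) / 2)) ↔
      0 < Real.sin ψ ∧ r * (E ^ 2 - r ^ 2) = k / ω := by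
  have hs := Real.sin_sq_add_cos_sq ψ
  have hD : r ^ 2 + E ^ 2 - 2 * r * E * Real.cos ψ = (E * Real.sin ψ) ^ 2 := by
    rw [h1]; linear_combination (-E ^ 2) * hs
  have hD2 : E ^ 2 - r ^ 2 = (E * Real.sin ψ) ^ 2 := by
    rw [h1]; linear_combination (-E ^ 2) * hs
  rw [hD, hD2]
  have key : 0 < Real.sin ψ → ((E * Real.sin ψ) ^ 2) ^ ((3 : ℝ) / 2) = (E * Real.sin ψ) ^ 3 := by
    intro h
    have : 0 < E * Real.sin ψ := by positivity
    rw [← Real.rpow_natCast, ← Real.rpow_mul this.le, ← Real.rpow_natCast]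
    norm_num
  constructor
  · intro h
    have hpos : 0 < Real.sin ψ := by
      by_contra hn
      have : k * E * Real.sin ψ / (r * ((E * Real.sin ψ) ^ 2) ^ ((3 : ℝ) / 2)) ≤ 0 :=
        div_nonpos_of_nonpos_of_nonneg
          (mul_nonpos_of_nonneg_of_nonpos (by positivity) (not_lt.1 hn)) (by positivity)
      linarith
    refine ⟨hpos, ?_⟩
    rw [key hpos] at h
    rw [h]; field_simp
  · rintro ⟨hpos, h⟩
    rw [key hpos]
    rw [eq_div_iff hω.ne'] at h
    rw [eq_div_iff (by positivity), ← h]; ring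

/-- Under `2k₁²R² > 1` and `κ < ln(2k₁²R²)/(2k₁)` there is a unique pair
`(r, ψ)` with `r > 0`, `ψ ∈ (−π, π]`, satisfying the equilibrium equations of the spiral
herding dynamics; moreover the unique `ψ` lies in `(0, π/2)`. -/
theorem spiral_equilibrium_pair_unique
    (k k₁ R ω κ : ℝ) (hk : 0 < k) (hk₁ : 0 < k₁) (hR : 0 < R) (hω : 0 < ω) (hκ : 0 < κ)
    (hgain : 1 < 2 * k₁ ^ 2 * R ^ 2)
    (hκ' : κ < Real.log (2 * k₁ ^ 2 * R ^ 2) / (2 * k₁)) :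
    (∃! p : ℝ × ℝ, 0 < p.1 ∧ p.2 ∈ Set.Ioc (-π) π ∧
        p.1 = R * Real.exp (k₁ * (p.1 - κ)) * Real.cos p.2 ∧
        ω = k * R * Real.exp (k₁ * (p.1 - κ)) * Real.sin p.2 /
          (p.1 * (p.1 ^ 2 + R ^ 2 * Real.exp (2 * k₁ * (p.1 - κ)) -
            2 * p.1 * R * Real.exp (k₁ * (p.1 - κ)) * Real.cos p.2) ^ ((3 : ℝ) / 2))) ∧
    (∀ p : ℝ × ℝ, 0 < p.1 → p.2 ∈ Set.Ioc (-π) π →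
        p.1 = R * Real.exp (k₁ * (p.1 - κ)) * Real.cos p.2 →
        ω = k * R * Real.exp (k₁ * (p.1 - κ)) * Real.sin p.2 /
          (p.1 * (p.1 ^ 2 + R ^ 2 * Real.exp (2 * k₁ * (p.1 - κ)) -
            2 * p.1 * R * Real.exp (k₁ * (p.1 - κ)) * Real.cos p.2) ^ ((3 : ℝ) / 2)) →
        p.2 ∈ Set.Ioo 0 (π / 2)) := by
  set A := R ^ 2 * Real.exp (-(2 * k₁ * κ)) with hAdef
  have hA0 : 0 < A := by positivity
  have hA : 1 < 2 * k₁ ^ 2 * A := by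
    rw [lt_div_iff₀ (by positivity), Real.lt_log_iff_exp_lt (by positivity)] at hκ'
    rw [hAdef, Real.exp_neg, ← mul_assoc, ← div_eq_mul_inv, lt_div_iff₀ (Real.exp_pos _)]
    rw [one_mul, show 2 * k₁ * κ = κ * (2 * k₁) by ring]; exact hκ'
  have hE2 : ∀ r, (R * Real.exp (k₁ * (r - κ))) ^ 2 = A * Real.exp (2 * k₁ * r) := by
    intro r
    rw [hAdef, mul_assoc, ← Real.exp_add, mul_pow, ← sp_exp]; congr 2; ring
  have hf0 : ∀ r, 0 ≤ r → A ≤ A * Real.exp (2 * k₁ * r) - r ^ 2 := by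
    intro r hr
    rcases hr.eq_or_lt with rfl | h
    · simp
    · have := sp_mono A k₁ 0 r hk₁ hA le_rfl h
      simp at this; linarith
  have hkey : ∀ r ψ : ℝ, 0 < r → r = R * Real.exp (k₁ * (r - κ)) * Real.cos ψ →
      (ω = k * R * Real.exp (k₁ * (r - κ)) * Real.sin ψ /
          (r * (r ^ 2 + R ^ 2 * Real.exp (2 * k₁ * (r - κ)) -
            2 * r * R * Real.exp (k₁ * (r - κ)) * Real.cos ψ) ^ ((3 : ℝ) / 2)) ↔
      0 < Real.sin ψ ∧ r * (A * Real.exp (2 * k₁ * r) - r ^ 2) = k / ω) := by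
    intro r ψ hr h
    have := sp_key k ω r (R * Real.exp (k₁ * (r - κ))) ψ hk hω hr (by positivity) h
    rw [hE2, ← hE2, mul_pow, ← sp_exp, ← mul_assoc, ← mul_assoc] at this
    rw [this, sp_exp, ← mul_pow, hE2]
  have hloc : ∀ r ψ : ℝ, 0 < r → ψ ∈ Set.Ioc (-π) π →
      r = R * Real.exp (k₁ * (r - κ)) * Real.cos ψ → 0 < Real.sin ψ → ψ ∈ Set.Ioo 0 (π / 2) := by
    intro r ψ hr hψ h hs
    have h0 : 0 < ψ := by
      by_contra hn
      have := Real.sin_nonpos_of_nonpos_of_neg_pi_le (not_lt.1 hn) hψ.1.le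
      linarith
    refine ⟨h0, ?_⟩
    by_contra hn
    have hc := Real.cos_nonpos_of_pi_div_two_le_of_le (not_lt.1 hn) (by linarith [hψ.2, Real.pi_pos])
    have : R * Real.exp (k₁ * (r - κ)) * Real.cos ψ ≤ 0 :=
      mul_nonpos_of_nonneg_of_nonpos (by positivity) hc
    linarith
  refine ⟨?_, fun p hp hψ h1 h2 => hloc p.1 p.2 hp hψ h1 ((hkey p.1 p.2 hp h1).1 h2).1⟩
  have hmono : ∀ a b : ℝ, 0 < a → a < b →
      a * (A * Real.exp (2 * k₁ * a) - a ^ 2) < b * (A * Real.exp (2 * k₁ * b) - b ^ 2) := by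
    intro a b ha hab
    have h1 := sp_mono A k₁ a b hk₁ hA ha.le hab
    have h2 := hf0 a ha.le
    exact mul_lt_mul'' hab h1 ha.le (by linarith)
  obtain ⟨r, hr0, hr⟩ : ∃ r, 0 < r ∧ r * (A * Real.exp (2 * k₁ * r) - r ^ 2) = k / ω := by
    have hc : ContinuousOn (fun r : ℝ => r * (A * Real.exp (2 * k₁ * r) - r ^ 2))
        (Set.Icc 0 (k / ω / A)) := by fun_prop
    have hM : 0 < k / ω / A := by positivity
    have hmem : k / ω ∈ Set.Icc ((fun r : ℝ => r * (A * Real.exp (2 * k₁ * r) - r ^ 2)) 0)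
        ((fun r : ℝ => r * (A * Real.exp (2 * k₁ * r) - r ^ 2)) (k / ω / A)) := by
      constructor
      · simp only [zero_mul]; positivity
      · have := mul_le_mul_of_nonneg_left (hf0 _ hM.le) hM.le
        rwa [div_mul_cancel₀ _ hA0.ne'] at this
    obtain ⟨r, hr, h⟩ := intermediate_value_Icc hM.le hc hmem
    refine ⟨r, lt_of_le_of_ne hr.1 ?_, h⟩
    rintro rfl
    simp only [zero_mul] at h
    have : 0 < k / ω := by positivity
    linarith
  set E := R * Real.exp (k₁ * (r - κ)) with hE
  have hEpos : 0 < E := by positivity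
  have hrE : r < E := by
    have := hf0 r hr0.le
    rw [← hE2] at this
    exact lt_of_pow_lt_pow_left₀ 2 hEpos.le (by linarith)
  have hq0 : 0 < r / E := by positivity
  have hq1 : r / E < 1 := (div_lt_one hEpos).2 hrE
  have hcos : Real.cos (Real.arccos (r / E)) = r / E := Real.cos_arccos (by linarith) hq1.le
  have heq : r = E * Real.cos (Real.arccos (r / E)) := by rw [hcos]; field_simp
  have hsin : 0 < Real.sin (Real.arccos (r / E)) := by
    rw [Real.sin_arccos]; apply Real.sqrt_pos.2; nlinarith
  refine ⟨(r, Real.arccos (r / E)), ⟨hr0, ⟨?_, Real.arccos_le_pi _⟩, heq,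
    (hkey _ _ hr0 heq).2 ⟨hsin, hr⟩⟩, ?_⟩
  · have := Real.arccos_nonneg (r / E)
    show -π < Real.arccos (r / E)
    linarith [Real.pi_pos]
  · rintro ⟨r', ψ⟩ ⟨h0, hψ, h1, h2⟩
    simp only at h0 hψ h1 h2
    obtain ⟨hs, h3⟩ := (hkey _ _ h0 h1).1 h2
    have hrr : r' = r := by
      rcases lt_trichotomy r' r with h | h | h
      · have := hmono _ _ h0 h; linarith
      · exact h
      · have := hmono _ _ hr0 h; linarith
    subst hrr
    have hl := hloc _ _ h0 hψ h1 hs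
    have : Real.cos ψ = r' / E := by rw [eq_div_iff hEpos.ne', mul_comm]; exact h1.symm
    rw [← this, Real.arccos_cos hl.1.le hψ.2]
end

section
/- Let k₁, R be positive real numbers with 2k₁²R² > 1, and let κ satisfy 0 < κ < ln(2k₁²R²)/(2k₁). Then there is no r > 0 satisfying r² = R²·e^{2k₁(r−κ)}. -/
open Real

/-- If `2k₁²R² > 1` and `0 < κ < ln(2k₁²R²)/(2k₁)`, then there is no `r > 0`
satisfying `r² = R²·e^{2k₁(r−κ)}`. -/
theorem no_positive_root_limit_equation
    (k₁ R κ : ℝ) (hk₁ : 0 < k₁) (hR : 0 < R)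
    (hgain : 1 < 2 * k₁ ^ 2 * R ^ 2)
    (hκ : 0 < κ) (hκ' : κ < Real.log (2 * k₁ ^ 2 * R ^ 2) / (2 * k₁)) :
    ¬ ∃ r : ℝ, 0 < r ∧ r ^ 2 = R ^ 2 * Real.exp (2 * k₁ * (r - κ)) := by
  rintro ⟨r, hr, h⟩
  have hE : Real.exp (2 * k₁ * κ) < 2 * k₁ ^ 2 * R ^ 2 := by
    rw [lt_div_iff₀ (by positivity)] at hκ'
    rw [← Real.lt_log_iff_exp_lt (by positivity)]
    linarith
  have hq := Real.quadratic_le_exp_of_nonneg (x := 2 * k₁ * r) (by positivity)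
  have h1 : r ^ 2 * Real.exp (2 * k₁ * κ) = R ^ 2 * Real.exp (2 * k₁ * r) := by
    rw [h, mul_assoc, ← Real.exp_add]
    congr 2
    ring
  have h2 : r ^ 2 * Real.exp (2 * k₁ * κ) < r ^ 2 * (2 * k₁ ^ 2 * R ^ 2) :=
    mul_lt_mul_of_pos_left hE (by positivity)
  have h3 := mul_le_mul_of_nonneg_left hq (sq_nonneg R)
  have h4 : 0 < R ^ 2 * (1 + 2 * k₁ * r) := by positivity
  nlinarith
end

section
/- Let k, k₁, R, κ be positive real numbers with 2k₁²R² > 1 and κ < ln(2k₁²R²)/(2k₁). Then for every ε > 0 there exists W > 0 such that for all ω > W, every positive real number r satisfying the spiral equilibrium equation r³ − R²·e^{2k₁(r−κ)}·r + k/ω = 0 satisfies r < ε. In other words, the equilibrium radius r*(ω) tends to 0 as ω → ∞. -/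
open Real

/-- Under `2k₁²R² > 1` and `κ < ln(2k₁²R²)/(2k₁)`, the equilibrium radius of
the spiral equilibrium equation tends to `0` as `ω → ∞`: for every `ε > 0` there is `W > 0`
such that for all `ω > W`, every positive root `r` of
`r³ − R²·e^{2k₁(r−κ)}·r + k/ω = 0` satisfies `r < ε`. -/
theorem spiral_equilibrium_radius_tendsto_zero
    (k k₁ R κ : ℝ) (hk : 0 < k) (hk₁ : 0 < k₁) (hR : 0 < R) (hκ : 0 < κ)
    (hgain : 1 < 2 * k₁ ^ 2 * R ^ 2)
    (hκ' : κ < Real.log (2 * k₁ ^ 2 * R ^ 2) / (2 * k₁)) :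
    ∀ ε > 0, ∃ W > 0, ∀ ω > W, ∀ r : ℝ, 0 < r →
      r ^ 3 - R ^ 2 * Real.exp (2 * k₁ * (r - κ)) * r + k / ω = 0 → r < ε := by
  intro ε hε
  refine ⟨2 * k₁ ^ 2 * k / ε, by positivity, ?_⟩
  intro ω hω r hr h
  have hW : 0 < 2 * k₁ ^ 2 * k / ε := by positivity
  have hω0 : 0 < ω := lt_trans hW hω
  have hc : 0 < 2 * k₁ ^ 2 * R ^ 2 := by linarith
  rw [lt_div_iff₀ (by positivity)] at hκ'
  have h1 : Real.exp (2 * k₁ * r) ≤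
      2 * k₁ ^ 2 * R ^ 2 * Real.exp (2 * k₁ * (r - κ)) := by
    calc Real.exp (2 * k₁ * r)
        ≤ Real.exp (Real.log (2 * k₁ ^ 2 * R ^ 2) + 2 * k₁ * (r - κ)) := by
          apply Real.exp_le_exp.mpr
          linarith
      _ = _ := by rw [Real.exp_add, Real.exp_log hc]
  have hx : 0 ≤ 2 * k₁ * r := by positivity
  have h2 := Real.quadratic_le_exp_of_nonneg hx
  have h3 : 1 + 2 * k₁ ^ 2 * r ^ 2 ≤
      2 * k₁ ^ 2 * R ^ 2 * Real.exp (2 * k₁ * (r - κ)) := by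
    nlinarith
  have h4 := mul_le_mul_of_nonneg_right h3 hr.le
  have h5 : r ≤ 2 * k₁ ^ 2 * (k / ω) := by
    have : k / ω = R ^ 2 * Real.exp (2 * k₁ * (r - κ)) * r - r ^ 3 := by linarith
    rw [this]
    linarith
  refine lt_of_le_of_lt h5 ?_
  have h6 : 2 * k₁ ^ 2 * k < ω * ε := (div_lt_iff₀ hε).mp hω
  rw [← mul_div_assoc, div_lt_iff₀ hω0]
  linarith
end

section
/- Let k, ω, R be positive real numbers with k/(ωR³) < 2/(3√3). Then there exist real numbers r₁, r₂, r₃ with R > r₁ > R/√3 > r₂ > 0 > r₃ such that x³ − R²x + k/ω = (x − r₁)(x − r₂)(x − r₃) for all real x; that is, the cubic x³ − R²x + k/ω = 0 has three real roots satisfying R > r₁ > R/√3 > r₂ > 0 > r₃. -/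
open Real

/-- If `k/(ωR³) < 2/(3√3)`, the cubic `x³ − R²x + k/ω` has three real roots
`r₁, r₂, r₃` satisfying `R > r₁ > R/√3 > r₂ > 0 > r₃`. -/
theorem circular_cubic_three_roots
    (k ω R : ℝ) (hk : 0 < k) (hω : 0 < ω) (hR : 0 < R)
    (h : k / (ω * R ^ 3) < 2 / (3 * Real.sqrt 3)) :
    ∃ r₁ r₂ r₃ : ℝ,
      R > r₁ ∧ r₁ > R / Real.sqrt 3 ∧ R / Real.sqrt 3 > r₂ ∧ r₂ > 0 ∧ 0 > r₃ ∧
      ∀ x : ℝ, x ^ 3 - R ^ 2 * x + k / ω = (x - r₁) * (x - r₂) * (x - r₃) := by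
  have ht : 0 < Real.sqrt 3 := by positivity
  have ht2 : Real.sqrt 3 ^ 2 = 3 := Real.sq_sqrt (by norm_num)
  have ht1 : 1 < Real.sqrt 3 := by nlinarith
  generalize Real.sqrt 3 = t at *
  have hs : 0 < R / t := by positivity
  have hRs : R = t * (R / t) := by field_simp
  have hc : 0 < k / ω := by positivity
  have h2 : k / ω < 2 / (3 * t) * R ^ 3 := by
    rw [← div_div, div_lt_iff₀ (by positivity)] at h
    exact h
  generalize k / ω = c at *
  generalize R / t = s at *
  subst hRs
  have h3 : 2 / (3 * t) * (t * s) ^ 3 = 2 * s ^ 3 := by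
    field_simp
    rw [ht2]
  rw [h3] at h2
  have hsR : s < t * s := by nlinarith
  have hq : (t * s) ^ 2 = 3 * s ^ 2 := by rw [mul_pow, ht2]
  have hcont : Continuous (fun x : ℝ => x ^ 3 - (t * s) ^ 2 * x + c) := by fun_prop
  obtain ⟨a, ⟨ha1, ha2⟩, ha⟩ := intermediate_value_Ioo hsR.le hcont.continuousOn
    (show (0 : ℝ) ∈ _ from ⟨by simp only [hq]; linarith, by ring_nf; linarith⟩)
  obtain ⟨b, ⟨hb1, hb2⟩, hb⟩ := intermediate_value_Ioo' hs.le hcont.continuousOn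
    (show (0 : ℝ) ∈ _ from ⟨by simp only [hq]; linarith, by ring_nf; linarith⟩)
  simp only at ha hb
  have hab : a ^ 2 + a * b + b ^ 2 = (t * s) ^ 2 := by
    have : a - b ≠ 0 := by intro h; linarith
    apply mul_left_cancel₀ this
    linear_combination ha - hb
  refine ⟨a, b, -(a + b), ha2, ha1, hb2, hb1, by linarith, fun x => ?_⟩
  linear_combination ha + (x - a) * hab
end

section
/- Let k, ω, R be positive real numbers with 0 < k/(ωR³) < 2/(3√3). Then the set of pairs (r, ψ) with r > 0 and ψ ∈ (0, π/2) satisfying r = R·cos(ψ) and cos(ψ)·sin²(ψ) = k/(ωR³) has exactly two elements: one pair with r ∈ (R/√3, R) and one pair with r ∈ (0, R/√3). -/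
open Real

/-- For `0 < k/(ωR³) < 2/(3√3)`, the set of equilibrium pairs `(r, ψ)` with
`r > 0`, `ψ ∈ (0, π/2)`, `r = R·cos ψ` and `cos ψ · sin² ψ = k/(ωR³)` has exactly two elements:
one with `r ∈ (R/√3, R)` and one with `r ∈ (0, R/√3)`. -/
theorem circular_equilibrium_two_points
    (k ω R : ℝ) (hk : 0 < k) (hω : 0 < ω) (hR : 0 < R)
    (h0 : 0 < k / (ω * R ^ 3)) (h : k / (ω * R ^ 3) < 2 / (3 * Real.sqrt 3)) :
    ∃ p q : ℝ × ℝ, p ≠ q ∧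
      {x : ℝ × ℝ | 0 < x.1 ∧ x.2 ∈ Set.Ioo 0 (π / 2) ∧ x.1 = R * Real.cos x.2 ∧
        Real.cos x.2 * Real.sin x.2 ^ 2 = k / (ω * R ^ 3)} = {p, q} ∧
      p.1 ∈ Set.Ioo (R / Real.sqrt 3) R ∧ q.1 ∈ Set.Ioo 0 (R / Real.sqrt 3) := by
  generalize k / (ω * R ^ 3) = c at h0 h ⊢
  obtain ⟨a, ha⟩ : ∃ a : ℝ, a = 1 / Real.sqrt 3 := ⟨_, rfl⟩
  have hs : 0 < Real.sqrt 3 := by positivity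
  have ha0 : 0 < a := by rw [ha]; positivity
  have ha2 : a ^ 2 = 1 / 3 := by
    rw [ha, div_pow, Real.sq_sqrt (by norm_num)]; norm_num
  have ha1 : a < 1 := by nlinarith
  have hRa : R / Real.sqrt 3 = R * a := by rw [ha]; ring
  have hc : c < a * (1 - a ^ 2) := by
    have e : 2 / (3 * Real.sqrt 3) = a * (1 - a ^ 2) := by
      rw [ha2, ha]; field_simp; norm_num
    rwa [← e]
  rw [hRa]
  have hcont : Continuous (fun x : ℝ => x * (1 - x ^ 2)) := by fun_prop
  obtain ⟨u, ⟨hu1, hu2⟩, hu⟩ : ∃ u ∈ Set.Ioo a 1, u * (1 - u ^ 2) = c :=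
    intermediate_value_Ioo' ha1.le hcont.continuousOn ⟨by norm_num; exact h0, hc⟩
  obtain ⟨v, ⟨hv1, hv2⟩, hv⟩ : ∃ v ∈ Set.Ioo 0 a, v * (1 - v ^ 2) = c :=
    intermediate_value_Ioo ha0.le hcont.continuousOn ⟨by norm_num; exact h0, hc⟩
  have key : ∀ w, 0 < w → w * (1 - w ^ 2) = c → w = u ∨ w = v := by
    intro w hw hwc
    by_contra! hne
    have e1 : u ^ 2 + u * v + v ^ 2 = 1 := by
      apply mul_left_cancel₀ (sub_ne_zero.2 (hv2.trans hu1).ne')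
      linear_combination hv - hu
    have e2 : u ^ 2 + u * w + w ^ 2 = 1 := by
      apply mul_left_cancel₀ (sub_ne_zero.2 hne.1)
      linear_combination hu - hwc
    have e3 : (w - v) * (u + v + w) = 0 := by linear_combination e2 - e1
    rcases mul_eq_zero.1 e3 with h1 | h1
    · exact hne.2 (sub_eq_zero.1 h1)
    · linarith
  have mem : ∀ w, 0 < w → w < 1 → w * (1 - w ^ 2) = c →
      (0 < R * w ∧ arccos w ∈ Set.Ioo 0 (π / 2) ∧ R * w = R * Real.cos (arccos w) ∧
        Real.cos (arccos w) * Real.sin (arccos w) ^ 2 = c) := by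
    intro w h1 h2 h3
    have hcw : Real.cos (arccos w) = w := Real.cos_arccos (by linarith) h2.le
    refine ⟨by positivity, ⟨Real.arccos_pos.2 h2, Real.arccos_lt_pi_div_two.2 h1⟩, by rw [hcw], ?_⟩
    rw [Real.sin_sq, hcw, h3]
  refine ⟨(R * u, arccos u), (R * v, arccos v), ?_, ?_, ?_, ?_⟩
  · intro e
    have := mul_left_cancel₀ hR.ne' (Prod.ext_iff.1 e).1
    linarith
  · ext ⟨r, ψ⟩
    simp only [Set.mem_setOf_eq, Set.mem_insert_iff, Set.mem_singleton_iff, Prod.mk.injEq]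
    constructor
    · rintro ⟨h1, ⟨h2, h3⟩, h4, h5⟩
      have hp : 0 < Real.cos ψ := Real.cos_pos_of_mem_Ioo ⟨by linarith, h3⟩
      have hψ : arccos (Real.cos ψ) = ψ := Real.arccos_cos h2.le (by linarith [Real.pi_pos])
      rw [Real.sin_sq] at h5
      rcases key _ hp h5 with e | e
      · left; rw [← e, hψ]; exact ⟨h4, rfl⟩
      · right; rw [← e, hψ]; exact ⟨h4, rfl⟩
    · rintro (⟨rfl, rfl⟩ | ⟨rfl, rfl⟩)
      · exact mem u (by linarith) hu2 hu
      · exact mem v hv1 (by linarith) hv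
  · exact ⟨by simpa using mul_lt_mul_of_pos_left hu1 hR, by simpa using mul_lt_mul_of_pos_left hu2 hR⟩
  · exact ⟨mul_pos hR hv1, mul_lt_mul_of_pos_left hv2 hR⟩
end

section
/- Let k, ω, R, r be positive real numbers with r < R/√3 and ω > 3√3·k/(2R³). Then 9k² − 4ω²(R² − r²)³ < k². Consequently, both complex numbers λ₁,₂ = (−k ± √d)/(2(R² − r²)^{3/2}), where d = 9k² − 4ω²(R² − r²)³ and √d denotes i·√(−d) when d < 0, have strictly negative real part. -/
open Real

/-- For `0 < r < R/√3` and `ω > 3√3·k/(2R³)`, the discriminant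
`d = 9k² − 4ω²(R²−r²)³` satisfies `d < k²`, and consequently both eigenvalues
`λ₁,₂ = (−k ± √d)/(2(R²−r²)^{3/2})` (with `√d = i·√(−d)` when `d < 0`) have strictly
negative real part: the inner equilibrium is asymptotically stable. -/
theorem inner_equilibrium_eigenvalues_stable
    (k ω R r : ℝ) (hk : 0 < k) (hω : 0 < ω) (hR : 0 < R) (hr : 0 < r)
    (hr' : r < R / Real.sqrt 3) (hω' : ω > 3 * Real.sqrt 3 * k / (2 * R ^ 3)) :
    9 * k ^ 2 - 4 * ω ^ 2 * (R ^ 2 - r ^ 2) ^ 3 < k ^ 2 ∧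
    (((-(k : ℂ) + (if 0 ≤ 9 * k ^ 2 - 4 * ω ^ 2 * (R ^ 2 - r ^ 2) ^ 3 then
          ((Real.sqrt (9 * k ^ 2 - 4 * ω ^ 2 * (R ^ 2 - r ^ 2) ^ 3) : ℝ) : ℂ)
        else Complex.I * ((Real.sqrt (-(9 * k ^ 2 - 4 * ω ^ 2 * (R ^ 2 - r ^ 2) ^ 3)) : ℝ) : ℂ))) /
        (2 * (((R ^ 2 - r ^ 2) ^ ((3 : ℝ) / 2) : ℝ) : ℂ))).re < 0) ∧
    (((-(k : ℂ) - (if 0 ≤ 9 * k ^ 2 - 4 * ω ^ 2 * (R ^ 2 - r ^ 2) ^ 3 then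
          ((Real.sqrt (9 * k ^ 2 - 4 * ω ^ 2 * (R ^ 2 - r ^ 2) ^ 3) : ℝ) : ℂ)
        else Complex.I * ((Real.sqrt (-(9 * k ^ 2 - 4 * ω ^ 2 * (R ^ 2 - r ^ 2) ^ 3)) : ℝ) : ℂ))) /
        (2 * (((R ^ 2 - r ^ 2) ^ ((3 : ℝ) / 2) : ℝ) : ℂ))).re < 0) := by
  have h3 : 0 < Real.sqrt 3 := by positivity
  have h33 : Real.sqrt 3 ^ 2 = 3 := Real.sq_sqrt (by norm_num)
  have h1 : 3 * r ^ 2 < R ^ 2 := by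
    rw [lt_div_iff₀ h3] at hr'
    have := pow_lt_pow_left₀ hr' (by positivity) (two_ne_zero)
    rw [mul_pow, h33] at this
    linarith
  have h2 : 27 * k ^ 2 < 4 * ω ^ 2 * R ^ 6 := by
    rw [gt_iff_lt, div_lt_iff₀ (by positivity)] at hω'
    have := pow_lt_pow_left₀ hω' (by positivity) (two_ne_zero)
    rw [mul_pow, mul_pow, h33] at this
    nlinarith
  have hq : 2 / 3 * R ^ 2 < R ^ 2 - r ^ 2 := by linarith
  have hpos : 0 < R ^ 2 - r ^ 2 := lt_trans (by positivity) hq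
  have hc : (2 / 3 * R ^ 2) ^ 3 < (R ^ 2 - r ^ 2) ^ 3 :=
    pow_lt_pow_left₀ hq (by positivity) (by norm_num)
  have hd : 9 * k ^ 2 - 4 * ω ^ 2 * (R ^ 2 - r ^ 2) ^ 3 < k ^ 2 := by
    have := mul_lt_mul_of_pos_left hc (show 0 < 4 * ω ^ 2 by positivity)
    nlinarith
  refine ⟨hd, ?_⟩
  generalize 9 * k ^ 2 - 4 * ω ^ 2 * (R ^ 2 - r ^ 2) ^ 3 = d at hd ⊢
  have hp : 0 < (R ^ 2 - r ^ 2) ^ ((3 : ℝ) / 2) := Real.rpow_pos_of_pos hpos _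
  generalize (R ^ 2 - r ^ 2) ^ ((3 : ℝ) / 2) = p at hp ⊢
  have hs : Real.sqrt d < k := (Real.sqrt_lt' hk).2 hd
  have hs0 := Real.sqrt_nonneg d
  have e : (2 * (p : ℂ)) = ((2 * p : ℝ) : ℂ) := by push_cast; rfl
  rw [e, Complex.div_ofReal_re, Complex.div_ofReal_re]
  constructor
  · apply div_neg_of_neg_of_pos _ (by positivity)
    split_ifs
    · simp only [Complex.add_re, Complex.neg_re, Complex.ofReal_re]; linarith
    · simp [hk]
  · apply div_neg_of_neg_of_pos _ (by positivity)
    split_ifs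
    · simp only [Complex.sub_re, Complex.neg_re, Complex.ofReal_re]; linarith
    · simp [hk]
end

section
/- Let ω, R, r be positive real numbers with R/√3 < r < R, and set k = ω·r·(R² − r²), which is the condition that r is a root of the cubic r³ − R²r + k/ω = 0. Then d = 9k² − 4ω²(R² − r²)³ satisfies d > k² > 0, and consequently the two real numbers λ₁ = (−k + √d)/(2(R² − r²)^{3/2}) and λ₂ = (−k − √d)/(2(R² − r²)^{3/2}) satisfy λ₁ > 0 > λ₂; that is, the outer equilibrium is a saddle point of the linearized dynamics. -/
open Real

/-- For `R/√3 < r < R` and `k = ω·r·(R²−r²)` (so that `r` is a root of the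
cubic `r³ − R²r + k/ω = 0`), the discriminant `d = 9k² − 4ω²(R²−r²)³` satisfies `d > k² > 0`,
and the real eigenvalues `λ₁ = (−k + √d)/(2(R²−r²)^{3/2})`, `λ₂ = (−k − √d)/(2(R²−r²)^{3/2})`
satisfy `λ₁ > 0 > λ₂`: the outer equilibrium is a saddle point. -/
theorem outer_equilibrium_saddle
    (ω R r : ℝ) (hω : 0 < ω) (hR : 0 < R) (hr : 0 < r)
    (hr₁ : R / Real.sqrt 3 < r) (hr₂ : r < R) :
    let k := ω * r * (R ^ 2 - r ^ 2)
    let d := 9 * k ^ 2 - 4 * ω ^ 2 * (R ^ 2 - r ^ 2) ^ 3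
    d > k ^ 2 ∧ k ^ 2 > 0 ∧
    (-k + Real.sqrt d) / (2 * (R ^ 2 - r ^ 2) ^ ((3 : ℝ) / 2)) > 0 ∧
    (0 : ℝ) > (-k - Real.sqrt d) / (2 * (R ^ 2 - r ^ 2) ^ ((3 : ℝ) / 2)) := by
  intro k d
  have hA : 0 < R ^ 2 - r ^ 2 := by nlinarith
  have hk : 0 < k := by positivity
  have h3 : 0 < 3 * r ^ 2 - R ^ 2 := by
    have hs : 0 < Real.sqrt 3 := by positivity
    have h := (div_lt_iff₀ hs).1 hr₁
    have hsq : Real.sqrt 3 ^ 2 = 3 := Real.sq_sqrt (by norm_num)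
    have h2 : R ^ 2 < (r * Real.sqrt 3) ^ 2 := pow_lt_pow_left₀ h hR.le (by norm_num)
    rw [mul_pow, hsq] at h2
    linarith
  have hd : d > k ^ 2 := by
    have h : d - k ^ 2 = 4 * ω ^ 2 * (R ^ 2 - r ^ 2) ^ 2 * (3 * r ^ 2 - R ^ 2) := by
      simp only [d, k]
      ring
    have : 0 < d - k ^ 2 := by
      rw [h]
      positivity
    linarith
  have hsd : k < Real.sqrt d := Real.lt_sqrt_of_sq_lt hd
  have hden : 0 < 2 * (R ^ 2 - r ^ 2) ^ ((3 : ℝ) / 2) := by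
    have := Real.rpow_pos_of_pos hA ((3 : ℝ) / 2)
    linarith
  refine ⟨hd, by positivity, div_pos (by linarith) hden, div_neg_of_neg_of_pos (by linarith) hden⟩
end
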